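/- arXiv:2206.07991 — 3 statements merged into one kernel-verified Lean document; each statement's English description precedes it below -/
import Mathlib

section
/- For every a ∈ [0,1], ∫_a^{a+1} (H_a(x) − ∫_a^{a+1} H_a(y) dy)² dx = ∫_0^1 (H(x) − ∫_0^1 H(y) dy)² dx; that is, the squared Cramér distance between μ and ν, computed by cutting the circle at the point a, does not depend on a (the Cramér distance is invariant under the choice of cutting point, hence under translation). -/
open MeasureTheory

/-- Cutting the circle at `a` instead of `0` does not change the integral: if `G` on `[a, a+1]`
is obtained from `g` on `[0, 1]` by wrapping around, then both have the same integral. -/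
theorem intervalIntegral_eq_of_wrap {E : Type*} [NormedAddCommGroup E] [NormedSpace ℝ E]
    {g G : ℝ → E} {a : ℝ} (ha : a ∈ Set.Icc (0:ℝ) 1)
    (hg : IntervalIntegrable g volume 0 1)
    (hG : ∀ u ∈ Set.Icc a (a+1), G u = if u ≤ 1 then g u else g (u-1)) :
    ∫ x in a..(a+1), G x = ∫ x in (0:ℝ)..1, g x := by
  obtain ⟨h0, h1⟩ := ha
  have hga : IntervalIntegrable g volume 0 a :=
    hg.mono_set (by rw [Set.uIcc_of_le h0, Set.uIcc_of_le zero_le_one]; gcongr)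
  have hg1 : IntervalIntegrable g volume a 1 :=
    hg.mono_set (by rw [Set.uIcc_of_le h1, Set.uIcc_of_le zero_le_one]; gcongr)
  have hshift : IntervalIntegrable (fun x => g (x - 1)) volume 1 (a+1) := by
    simpa using hga.comp_sub_right 1
  have left : Set.EqOn g G (Set.uIoc a 1) := by
    intro u hu
    rw [Set.uIoc_of_le h1] at hu
    rw [hG u ⟨hu.1.le, by linarith [hu.2]⟩, if_pos hu.2]
  have right : Set.EqOn (fun x => g (x - 1)) G (Set.uIoc 1 (a+1)) := by
    intro u hu
    rw [Set.uIoc_of_le (by linarith)] at hu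
    rw [hG u ⟨by linarith [hu.1], hu.2⟩, if_neg (not_le.2 hu.1)]
  rw [← intervalIntegral.integral_add_adjacent_intervals (hg1.congr left) (hshift.congr right),
    ← intervalIntegral.integral_congr_ae (.of_forall left),
    ← intervalIntegral.integral_congr_ae (.of_forall right),
    intervalIntegral.integral_comp_sub_right, sub_self, add_sub_cancel_right, add_comm,
    intervalIntegral.integral_add_adjacent_intervals hga hg1]

theorem monotone_measureReal_Icc (μ : Measure ℝ) [IsFiniteMeasure μ] (a : ℝ) :
    Monotone fun u => (μ (Set.Icc a u)).toReal := fun _ _ h =>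
  ENNReal.toReal_mono (measure_ne_top _ _) (measure_mono (Set.Icc_subset_Icc_right h))

/-- Let `μ`, `ν` be probability measures on `ℝ` concentrated on `[0,1)`
(thought of as measures on the circle), `H u = μ([0,u]) − ν([0,u])` the difference of their
cumulative distribution functions, and for `a ∈ [0,1]` let `H_a` be the difference of the
cumulative distribution functions computed on the fundamental domain `[a, a+1]`. Then the
squared Cramér distance computed by cutting the circle at `a` does not depend on `a`:
`∫_a^{a+1} (H_a(x) − ∫_a^{a+1} H_a)² dx = ∫_0^1 (H(x) − ∫_0^1 H)² dx`. -/
theorem stmt0 (μ ν : Measure ℝ) [IsProbabilityMeasure μ] [IsProbabilityMeasure ν]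
    (hμ : μ (Set.Ico (0:ℝ) 1) = 1) (hν : ν (Set.Ico (0:ℝ) 1) = 1)
    (H : ℝ → ℝ)
    (hH : ∀ u : ℝ, H u = (μ (Set.Icc 0 u)).toReal - (ν (Set.Icc 0 u)).toReal)
    (a : ℝ) (ha : a ∈ Set.Icc (0:ℝ) 1)
    (Ha : ℝ → ℝ)
    (hHa : ∀ u ∈ Set.Icc a (a+1), Ha u = if u ≤ 1 then H u - H a else H (u-1) - H a) :
    ∫ x in a..(a+1), (Ha x - ∫ y in a..(a+1), Ha y)^2
      = ∫ x in (0:ℝ)..1, (H x - ∫ y in (0:ℝ)..1, H y)^2 := by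
  have hmeas : Measurable H := by
    rw [funext hH]
    exact (monotone_measureReal_Icc μ 0).measurable.sub (monotone_measureReal_Icc ν 0).measurable
  have hbound : ∀ u, |H u| ≤ 1 := fun u => by
    have hμu : (μ (Set.Icc 0 u)).toReal ≤ 1 := measureReal_le_one
    have hνu : (ν (Set.Icc 0 u)).toReal ≤ 1 := measureReal_le_one
    have hμ0 : 0 ≤ (μ (Set.Icc 0 u)).toReal := ENNReal.toReal_nonneg
    have hν0 : 0 ≤ (ν (Set.Icc 0 u)).toReal := ENNReal.toReal_nonneg
    rw [hH, abs_le]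
    constructor <;> linarith
  have hint : IntervalIntegrable H volume 0 1 :=
    intervalIntegrable_const (c := (1:ℝ)) |>.mono_fun hmeas.aestronglyMeasurable
      (.of_forall fun u => by simpa using hbound u)
  set m := ∫ y in (0:ℝ)..1, H y with hm
  have hmean : ∫ y in a..(a+1), Ha y = m - H a := by
    rw [intervalIntegral_eq_of_wrap (g := fun u => H u - H a) ha
      (hint.sub intervalIntegrable_const) hHa,
      intervalIntegral.integral_sub hint intervalIntegrable_const]
    simp [hm]
  have hsq : IntervalIntegrable (fun u => (H u - m)^2) volume 0 1 :=
    intervalIntegrable_const (c := (1 + |m|)^2) |>.mono_fun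
      ((hmeas.sub_const m).pow_const 2).aestronglyMeasurable
      (.of_forall fun u => by
        simp only [norm_pow, Real.norm_eq_abs]
        refine pow_le_pow_left₀ (abs_nonneg _) ?_ 2
        exact (abs_sub _ _).trans <| (add_le_add_left (hbound u) _).trans (le_abs_self _))
  rw [hmean]
  refine intervalIntegral_eq_of_wrap ha hsq fun u hu => ?_
  rw [hHa u hu]
  split_ifs <;> ring
end

section
/- dC(μ,ν)² ≤ 2·W₁(μ,ν), i.e. ⨅_{c∈ℝ} ∫_0^1 (H(x) − c)² dx ≤ 2·⨅_{c∈ℝ} ∫_0^1 |H(x) − c| dx; consequently dC(μ,ν) ≤ √2·W₁(μ,ν)^{1/2}, so W₁ and dC span the same (weak-*) topology. -/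
open MeasureTheory

/-- Projecting `c` onto `[-M, M]` does not increase its distance to a point `y` of that interval,
and the projected distance is at most `2 * M`. -/
lemma sq_sub_clamp_le {M y c : ℝ} (hy : |y| ≤ M) :
    (y - max (-M) (min c M)) ^ 2 ≤ 2 * M * |y - c| := by
  obtain ⟨h₁, h₂⟩ := abs_le.mp hy
  have hle : |y - max (-M) (min c M)| ≤ |y - c| := by
    rcases max_cases (-M) (min c M) with h | h <;> rcases min_cases c M with h' | h' <;>
      rcases abs_cases (y - c) with h'' | h'' <;> rw [abs_le] <;> constructor <;> linarith
  have hM : |y - max (-M) (min c M)| ≤ 2 * M := by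
    have hlow : -M ≤ max (-M) (min c M) := le_max_left _ _
    have hupp : max (-M) (min c M) ≤ M := max_le (by linarith) (min_le_right _ _)
    rw [abs_le]
    constructor <;> linarith
  rw [← sq_abs, sq]
  exact mul_le_mul hM hle (abs_nonneg _) (by linarith)

/-- For a measurable function bounded by `M`, the squared `L²` distance to the constants is at most
`2 * M` times the `L¹` distance to the constants. -/
lemma iInf_integral_sq_sub_le {f : ℝ → ℝ} {M a b : ℝ} (hf : Measurable f)
    (hM : ∀ x, |f x| ≤ M) (hab : a ≤ b) :
    (⨅ c : ℝ, ∫ x in a..b, (f x - c) ^ 2) ≤ 2 * M * ⨅ c : ℝ, ∫ x in a..b, |f x - c| := by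
  have hM₀ : 0 ≤ M := (abs_nonneg _).trans (hM 0)
  have hbound (c x : ℝ) : |f x - c| ≤ M + |c| := (abs_sub _ _).trans (by gcongr; exact hM x)
  have hsq (c : ℝ) : IntervalIntegrable (fun x ↦ (f x - c) ^ 2) volume a b :=
    (intervalIntegrable_const (c := (M + |c|) ^ 2)).mono_fun
      ((hf.sub_const c).pow_const 2).aestronglyMeasurable
      (Filter.Eventually.of_forall fun x ↦ by
        simp only [norm_pow, Real.norm_eq_abs]
        exact pow_le_pow_left₀ (abs_nonneg _) ((hbound c x).trans (le_abs_self _)) 2)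
  have habs (c : ℝ) : IntervalIntegrable (fun x ↦ |f x - c|) volume a b :=
    (intervalIntegrable_const (c := M + |c|)).mono_fun
      (hf.sub_const c).norm.aestronglyMeasurable
      (Filter.Eventually.of_forall fun x ↦ by
        simp only [Real.norm_eq_abs, abs_abs]
        exact (hbound c x).trans (le_abs_self _))
  rw [Real.mul_iInf_of_nonneg (by positivity)]
  refine le_ciInf fun c ↦ ?_
  have hbdd : BddBelow (Set.range fun c : ℝ ↦ ∫ x in a..b, (f x - c) ^ 2) :=
    ⟨0, by
      rintro _ ⟨c, rfl⟩
      exact intervalIntegral.integral_nonneg hab fun x _ ↦ sq_nonneg _⟩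
  refine (ciInf_le hbdd (max (-M) (min c M))).trans ?_
  rw [← intervalIntegral.integral_const_mul]
  exact intervalIntegral.integral_mono_on hab (hsq _) ((habs c).const_mul _)
    fun x _ ↦ sq_sub_clamp_le (hM x)

/-- The mass `μ [a, u]` is a measurable function of `u`. -/
lemma measurable_measureReal_Icc (μ : Measure ℝ) [IsFiniteMeasure μ] (a : ℝ) :
    Measurable fun u ↦ (μ (Set.Icc a u)).toReal :=
  Monotone.measurable fun _ _ h ↦
    ENNReal.toReal_mono (measure_ne_top _ _) (measure_mono (Set.Icc_subset_Icc_right h))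

/-- Let `μ`, `ν` be probability measures on `ℝ` concentrated on `[0,1)`,
`H u = μ([0,u]) − ν([0,u])`. Then `dC(μ,ν)² ≤ 2·W₁(μ,ν)`, and consequently
`dC(μ,ν) ≤ √2 · W₁(μ,ν)^{1/2}` (so `W₁` and `dC` span the same, weak-*, topology). -/
theorem stmt2 (μ ν : Measure ℝ) [IsProbabilityMeasure μ] [IsProbabilityMeasure ν]
    (hμ : μ (Set.Ico (0:ℝ) 1) = 1) (hν : ν (Set.Ico (0:ℝ) 1) = 1)
    (H : ℝ → ℝ)
    (hH : ∀ u : ℝ, H u = (μ (Set.Icc 0 u)).toReal - (ν (Set.Icc 0 u)).toReal) :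
    ((⨅ c : ℝ, ∫ x in (0:ℝ)..1, (H x - c)^2)
        ≤ 2 * (⨅ c : ℝ, ∫ x in (0:ℝ)..1, |H x - c|)) ∧
      (Real.sqrt (⨅ c : ℝ, ∫ x in (0:ℝ)..1, (H x - c)^2)
        ≤ Real.sqrt 2 * Real.sqrt (⨅ c : ℝ, ∫ x in (0:ℝ)..1, |H x - c|)) := by
  have hmeas : Measurable H := by
    rw [funext hH]
    exact (measurable_measureReal_Icc μ 0).sub (measurable_measureReal_Icc ν 0)
  have hbound (x : ℝ) : |H x| ≤ 1 := by
    rw [hH]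
    exact abs_sub_le_of_nonneg_of_le ENNReal.toReal_nonneg measureReal_le_one
      ENNReal.toReal_nonneg measureReal_le_one
  have hle := iInf_integral_sq_sub_le hmeas hbound zero_le_one
  rw [mul_one] at hle
  refine ⟨hle, ?_⟩
  rw [← Real.sqrt_mul zero_le_two]
  exact Real.sqrt_le_sqrt hle
end

section
/- For every x ∈ ℤ one has (−λ_1·x, 0, …, 0) = N·(ℓ̂^1(x), …, ℓ̂^k(x)) + ε_x^k, and this is the unique decomposition of the vector (−λ_1·x, 0, …, 0) ∈ ℝ^k as the sum of an element of the lattice Nℤ^k and an element of the cube (−1/2, 1/2]^k; in other words, ε_x^k is the projection of this vector on the fundamental domain (−1/2,1/2]^k of ℝ^k modulo Nℤ^k. -/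
open MeasureTheory Filter

noncomputable section

/-- Iterated discretizations: given an abstract discretization operator `Dh` (where `Dh l` is
the discretization of `y ↦ l·y`, pinned down uniquely by the hypothesis
`(Dh l x : ℝ) − l·x ∈ (−1/2, 1/2]`) and multipliers `lam 1, …, lam k`, `iterD Dh lam m x` is
`ℓ̂^m(x) = (ℓ̂_m ∘ ⋯ ∘ ℓ̂_1)(x)` (with `ℓ̂^0 = id`). -/
def iterD (Dh : ℝ → ℤ → ℤ) (lam : ℕ → ℝ) : ℕ → ℤ → ℤ
  | 0, x => x
  | m + 1, x => Dh (lam (m + 1)) (iterD Dh lam m x)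

/-- The `m`-th roundoff error `e_x^m = ℓ̂_m(ℓ̂^{m−1}(x)) − λ_m·ℓ̂^{m−1}(x)` (for `m ≥ 1`). -/
def errD (Dh : ℝ → ℤ → ℤ) (lam : ℕ → ℝ) (m : ℕ) (x : ℤ) : ℝ :=
  (iterD Dh lam m x : ℝ) - lam m * (iterD Dh lam (m - 1) x : ℝ)

/-- The `k×k` matrix `N` with diagonal entries `−1`, subdiagonal entries `N_{m+1,m} = λ_{m+1}`
(in `1`-indexed notation), and all other entries `0`. -/
def NN (lam : ℕ → ℝ) (k : ℕ) : Matrix (Fin k) (Fin k) ℝ :=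
  Matrix.of fun i j =>
    if i = j then (-1 : ℝ) else if (i : ℕ) = (j : ℕ) + 1 then lam ((i : ℕ) + 1) else 0

theorem NN_mulVec_zero (lam : ℕ → ℝ) {k : ℕ} (v : Fin k → ℝ) (h : 0 < k) :
    (NN lam k).mulVec v ⟨0, h⟩ = -v ⟨0, h⟩ := by
  rw [Matrix.mulVec, dotProduct, Finset.sum_eq_single ⟨0, h⟩]
  · simp [NN]
  · intro j _ hj
    simp [NN, hj.symm]
  · simp

theorem NN_mulVec_succ (lam : ℕ → ℝ) {k : ℕ} (v : Fin k → ℝ) {n : ℕ} (h : n + 1 < k) :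
    (NN lam k).mulVec v ⟨n + 1, h⟩
      = lam (n + 2) * v ⟨n, n.lt_succ_self.trans h⟩ - v ⟨n + 1, h⟩ := by
  have hne : (⟨n, n.lt_succ_self.trans h⟩ : Fin k) ≠ ⟨n + 1, h⟩ := by simp
  rw [Matrix.mulVec, dotProduct, Finset.sum_eq_add _ _ hne]
  · simp [NN, sub_eq_add_neg]
  · rintro j - ⟨hj₁, hj₂⟩
    have hj : n ≠ (j : ℕ) := fun e => hj₁ (Fin.ext e.symm)
    simp [NN, hj₂.symm, hj]
  · simp
  · simp

/-- The discretization of a real number is unique. -/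
theorem int_eq_of_sub_mem_Ioc {a b : ℤ} {y : ℝ} (ha : (a : ℝ) - y ∈ Set.Ioc (-(1 : ℝ) / 2) (1 / 2))
    (hb : (b : ℝ) - y ∈ Set.Ioc (-(1 : ℝ) / 2) (1 / 2)) : a = b := by
  obtain ⟨ha₁, ha₂⟩ := ha
  obtain ⟨hb₁, hb₂⟩ := hb
  have h₁ : (a : ℝ) < b + 1 := by linarith
  have h₂ : (b : ℝ) < a + 1 := by linarith
  norm_cast at h₁ h₂
  omega

/-- For every `x ∈ ℤ`, `(−λ_1·x, 0, …, 0) = N·(ℓ̂^1(x), …, ℓ̂^k(x)) + ε_x^k`,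
and this is the unique decomposition of `(−λ_1·x, 0, …, 0)` as a sum of an element of the
lattice `Nℤ^k` and an element of the cube `(−1/2, 1/2]^k`. -/
theorem stmt4 (k : ℕ) (hk : 1 ≤ k) (Dh : ℝ → ℤ → ℤ) (lam : ℕ → ℝ)
    (hD : ∀ (l : ℝ) (x : ℤ), ((Dh l x : ℝ) - l * x) ∈ Set.Ioc (-(1:ℝ)/2) (1/2))
    (hlam : ∀ m ∈ Finset.Icc 1 k, 1 < lam m) :
    ∀ x : ℤ,
      ((fun i : Fin k => if (i : ℕ) = 0 then -(lam 1) * (x : ℝ) else 0)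
          = (NN lam k).mulVec (fun i : Fin k => (iterD Dh lam ((i : ℕ) + 1) x : ℝ))
            + fun i : Fin k => errD Dh lam ((i : ℕ) + 1) x)
      ∧ (∀ i : Fin k, errD Dh lam ((i : ℕ) + 1) x ∈ Set.Ioc (-(1:ℝ)/2) (1/2))
      ∧ ∀ (c : Fin k → ℤ) (w : Fin k → ℝ),
          (∀ i : Fin k, w i ∈ Set.Ioc (-(1:ℝ)/2) (1/2)) →
          ((fun i : Fin k => if (i : ℕ) = 0 then -(lam 1) * (x : ℝ) else 0)
            = (NN lam k).mulVec (fun i : Fin k => (c i : ℝ)) + w) →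
          c = (fun i : Fin k => iterD Dh lam ((i : ℕ) + 1) x)
            ∧ w = fun i : Fin k => errD Dh lam ((i : ℕ) + 1) x := by
  intro x
  refine ⟨?_, fun i => hD _ _, fun c w hw hc => ?_⟩
  · funext ⟨n, hn⟩
    cases n with
    | zero =>
      simp [NN_mulVec_zero, errD, iterD]
      ring
    | succ n => simp [NN_mulVec_succ, errD]
  · have hc_eq : ∀ (n : ℕ) (hn : n < k), c ⟨n, hn⟩ = iterD Dh lam (n + 1) x
        ∧ w ⟨n, hn⟩ = errD Dh lam (n + 1) x := by
      intro n
      induction n with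
      | zero =>
        intro hn
        have h := congrFun hc ⟨0, hn⟩
        simp only [Pi.add_apply, NN_mulVec_zero, if_true] at h
        have hw_eq : w ⟨0, hn⟩ = (c ⟨0, hn⟩ : ℝ) - lam 1 * x := by linarith
        have hmem := hw ⟨0, hn⟩
        rw [hw_eq] at hmem
        have hcn : c ⟨0, hn⟩ = iterD Dh lam 1 x := int_eq_of_sub_mem_Ioc hmem (hD _ _)
        exact ⟨hcn, by rw [hw_eq, hcn]; rfl⟩
      | succ n ih =>
        intro hn
        have h := congrFun hc ⟨n + 1, hn⟩
        simp only [Pi.add_apply, NN_mulVec_succ, Nat.add_eq_zero_iff, one_ne_zero, and_false,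
          if_false, (ih (n.lt_succ_self.trans hn)).1] at h
        have hw_eq : w ⟨n + 1, hn⟩
            = (c ⟨n + 1, hn⟩ : ℝ) - lam (n + 2) * iterD Dh lam (n + 1) x := by linarith
        have hmem := hw ⟨n + 1, hn⟩
        rw [hw_eq] at hmem
        have hcn : c ⟨n + 1, hn⟩ = iterD Dh lam (n + 2) x := int_eq_of_sub_mem_Ioc hmem (hD _ _)
        exact ⟨hcn, by rw [hw_eq, hcn]; rfl⟩
    exact ⟨funext fun i => (hc_eq i i.2).1, funext fun i => (hc_eq i i.2).2⟩
end
end
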